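/- Let p > 5 be prime and let A be a brace of cardinality p^4 with (A,+) ≅ C_p × C_{p^3}, whose group (A,∘) is generated by elements P, Q satisfying P^{p^3} = 1, Q^p = 1, Q^{-1}∘P∘Q = P^{1+p^2} (powers and inverses in (A,∘)), and such that p·Q = 0 in (A,+). Then x ∗ (p^2·a) = 0 for all x, a ∈ A (in particular Q∗(p^2·a) = P∗(p^2·a) = 0), and A is right nilpotent. -/

import Mathlib

/-- A (left) brace: an abelian group `(A,+)` and a group `(A,∘)` (written `*`)
on the same underlying set, with `a∘(b+c)+a = a∘b+a∘c`; the identity of `(A,∘)`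
coincides with `0`. -/
class Brace (A : Type*) extends AddCommGroup A, Group A where
  mul_add_left : ∀ a b c : A, a * (b + c) + a = a * b + a * c
  one_eq_zero : (1 : A) = 0

namespace Brace

variable {A : Type*} [Brace A]

/-- The star operation `a ∗ b = a∘b - a - b`. -/
def bstar (a b : A) : A := a * b - a - b

/-- `X ∗ Y`: the additive subgroup generated by `{x∗y : x ∈ X, y ∈ Y}`. -/
def starSpan (A : Type*) [Brace A] (X Y : Set A) : AddSubgroup A :=
  AddSubgroup.closure {z : A | ∃ x ∈ X, ∃ y ∈ Y, z = bstar x y}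

/-- `A² = A ∗ A`. -/
def sq (A : Type*) [Brace A] : AddSubgroup A := starSpan A Set.univ Set.univ

/-- `A³ = A ∗ A²`. -/
def cube (A : Type*) [Brace A] : AddSubgroup A := starSpan A Set.univ (sq A : Set A)

/-- The right series: `rightSeries A 0 = A^(1) = A`, `rightSeries A (n+1) = A^(n+1+1) = A^(n+1) ∗ A`. -/
def rightSeries (A : Type*) [Brace A] : ℕ → AddSubgroup A
  | 0 => ⊤
  | n + 1 => starSpan A (rightSeries A n : Set A) Set.univ

/-- A brace is right nilpotent if `A^(n) = 0` for some `n`. -/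
def RightNilpotent (A : Type*) [Brace A] : Prop := ∃ n : ℕ, rightSeries A n = ⊥

/-- `c ∈ Z(A)`: `c∗a = a∗c` for all `a`. -/
def IsCentral (c : A) : Prop := ∀ a : A, bstar c a = bstar a c

end Brace

namespace Brace

section Basic

variable {A : Type*} [Brace A]

lemma mul_eq_add_add_bstar (a b : A) : a * b = a + b + bstar a b := by
  unfold bstar; abel

lemma bstar_add (a b c : A) : bstar a (b + c) = bstar a b + bstar a c := by
  have h := eq_sub_of_add_eq (Brace.mul_add_left a b c)
  unfold bstar
  rw [h]; abel

lemma bstar_mul (a b c : A) :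
    bstar (a * b) c = bstar a c + bstar b c + bstar a (bstar b c) := by
  have h : a * b * c = a * (b * c) := mul_assoc a b c
  rw [mul_eq_add_add_bstar (a * b) c, mul_eq_add_add_bstar b c,
    mul_eq_add_add_bstar a (b + c + bstar b c), bstar_add, bstar_add,
    mul_eq_add_add_bstar a b] at h
  rw [mul_eq_add_add_bstar a b]
  have h' := eq_sub_of_add_eq' h
  rw [h']; abel

lemma one_bstar (a : A) : bstar 1 a = 0 := by
  rw [bstar, one_mul, sub_right_comm, sub_self, zero_sub, Brace.one_eq_zero, neg_zero]

/-- Left multiplication `a ∗ ·` by the star operation, as an additive endomorphism. -/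
def starHom (a : A) : A →+ A := AddMonoidHom.mk' (bstar a) (bstar_add a)

lemma bstar_nsmul (a : A) (n : ℕ) (b : A) : bstar a (n • b) = n • bstar a b :=
  (starHom a).map_nsmul n b

lemma bstar_zsmul (a : A) (n : ℤ) (b : A) : bstar a (n • b) = n • bstar a b :=
  (starHom a).map_zsmul n b

/-- The map `λ_a : b ↦ a ∘ b - a = a ∗ b + b`, as an additive endomorphism. -/
def lambdaHom (a : A) : A →+ A := starHom a + AddMonoidHom.id A

lemma lambdaHom_apply (a b : A) : lambdaHom a b = bstar a b + b := rfl

lemma lambdaHom_iterate (a b : A) (n : ℕ) :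
    (lambdaHom a)^[n] b = bstar (a ^ n) b + b := by
  induction n with
  | zero => simp [one_bstar]
  | succ n ih =>
    rw [Function.iterate_succ_apply', ih, lambdaHom_apply, pow_succ', bstar_mul, bstar_add]
    abel

lemma bstar_pow_of_cube_eq_zero (a b : A) (h : bstar a (bstar a (bstar a b)) = 0) (n : ℕ) :
    bstar (a ^ n) b = n • bstar a b + n.choose 2 • bstar a (bstar a b) := by
  induction n with
  | zero => simp [one_bstar]
  | succ n ih =>
    rw [pow_succ', bstar_mul, ih, bstar_add, bstar_nsmul, bstar_nsmul, h,
      Nat.choose_succ_succ' n 1, Nat.choose_one_right]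
    module

lemma pow_of_cube_eq_zero (a : A) (h : bstar a (bstar a (bstar a a)) = 0) (n : ℕ) :
    a ^ n = n • a + n.choose 2 • bstar a a + n.choose 3 • bstar a (bstar a a) := by
  induction n with
  | zero => simp [Brace.one_eq_zero]
  | succ n ih =>
    rw [pow_succ', mul_eq_add_add_bstar, ih, bstar_add, bstar_add, bstar_nsmul, bstar_nsmul,
      bstar_nsmul, h, Nat.choose_succ_succ' n 1, Nat.choose_succ_succ' n 2,
      Nat.choose_one_right]
    module

end Basic

end Brace

/-- If an additive endomorphism `φ` preserving `S` has `p`-power order on `u` and acts on the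
order-`p` class of `u` modulo `S` by an integer scalar, then it fixes that class. -/
lemma AddMonoidHom.sub_mem_of_iterate_prime_pow {A : Type*} [AddCommGroup A] {p : ℕ}
    (hp : p.Prime) (φ : A →+ A) (S : AddSubgroup A) (hS : ∀ s ∈ S, φ s ∈ S) (u : A)
    (hpu : (p : ℤ) • u ∈ S) (hu : u ∉ S) (m : ℤ) (hm : φ u - m • u ∈ S) (k : ℕ)
    (hk : φ^[p ^ k] u = u) : φ u - u ∈ S := by
  have hpow : ∀ n : ℕ, φ^[n] u - m ^ n • u ∈ S := by
    intro n
    induction n with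
    | zero => simp
    | succ n ih =>
      have h := S.add_mem (hS _ ih) (S.zsmul_mem hm (m ^ n))
      rw [map_sub, map_zsmul] at h
      rw [Function.iterate_succ_apply']
      convert h using 1
      module
  have hdvd : (p : ℤ) ∣ m ^ (p ^ k) - 1 := by
    by_contra hnd
    have hcop := (Nat.prime_iff_prime_int.mp hp).coprime_iff_not_dvd.mpr hnd
    obtain ⟨x, y, hxy⟩ := hcop
    apply hu
    have h := hpow (p ^ k)
    rw [hk] at h
    have h2 := S.sub_mem (S.zsmul_mem hpu x) (S.zsmul_mem h y)
    convert h2 using 1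
    calc u = (x * p + y * (m ^ p ^ k - 1)) • u := by rw [hxy, one_smul]
      _ = _ := by module
  have hdvd' : (p : ℤ) ∣ m - 1 := by
    have := Fact.mk hp
    rw [← ZMod.intCast_zmod_eq_zero_iff_dvd] at hdvd ⊢
    push_cast at hdvd ⊢
    rwa [ZMod.pow_card_pow] at hdvd
  obtain ⟨t, ht⟩ := hdvd'
  have h := S.add_mem hm (S.zsmul_mem hpu t)
  convert h using 1
  have : m = 1 + p * t := by linarith
  rw [this]
  module

namespace Brace

/-- `u`, `v` form a basis of the additive group, of orders `p` and `p ^ 3` respectively. -/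
structure IsBasisCpCp3 {A : Type*} [AddCommGroup A] (p : ℕ) (u v : A) : Prop where
  exists_eq : ∀ a : A, ∃ i j : ℤ, a = i • u + j • v
  eq_zero_iff : ∀ i j : ℤ, i • u + j • v = 0 ↔ (p : ℤ) ∣ i ∧ (p : ℤ) ^ 3 ∣ j

lemma exists_isBasisCpCp3 {A : Type*} [AddCommGroup A] {p : ℕ}
    (f : A ≃+ ZMod p × ZMod (p ^ 3)) : ∃ u v : A, IsBasisCpCp3 p u v := by
  refine ⟨f.symm (1, 0), f.symm (0, 1), fun a => ?_, fun i j => ?_⟩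
  · obtain ⟨i, hi⟩ := ZMod.intCast_surjective (f a).1
    obtain ⟨j, hj⟩ := ZMod.intCast_surjective (f a).2
    refine ⟨i, j, f.injective ?_⟩
    ext <;> simp [hi, hj]
  · rw [← f.map_eq_zero_iff, map_add, map_zsmul, map_zsmul, Prod.ext_iff]
    simp only [AddEquiv.apply_symm_apply, Prod.smul_mk, Prod.mk_add_mk, smul_zero, add_zero,
      zero_add, Prod.fst_zero, Prod.snd_zero, zsmul_one]
    rw [ZMod.intCast_zmod_eq_zero_iff_dvd, ← Nat.cast_pow, ← ZMod.intCast_zmod_eq_zero_iff_dvd]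
    simp [ZMod.intCast_zmod_eq_zero_iff_dvd]

namespace IsBasisCpCp3

section AddGroup

variable {A : Type*} [AddCommGroup A] {p : ℕ} {u v : A} (h : IsBasisCpCp3 p u v)
include h

lemma smul_fst : (p : ℤ) • u = 0 := by
  simpa using (h.eq_zero_iff p 0).mpr (by simp)

lemma cube_smul (a : A) : (p : ℤ) ^ 3 • a = 0 := by
  obtain ⟨i, j, rfl⟩ := h.exists_eq a
  rw [smul_add, smul_smul, smul_smul, h.eq_zero_iff]
  exact ⟨Dvd.intro (p ^ 2 * i) (by ring), Dvd.intro _ rfl⟩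

lemma exists_of_smul_eq_zero (hp : p ≠ 0) {a : A} (ha : (p : ℤ) • a = 0) :
    ∃ i : ℤ, ∃ b : A, a = i • u + (p : ℤ) ^ 2 • b := by
  obtain ⟨i, j, rfl⟩ := h.exists_eq a
  rw [smul_add, smul_smul, smul_smul, h.eq_zero_iff, pow_succ'] at ha
  obtain ⟨t, rfl⟩ := (mul_dvd_mul_iff_left (Int.natCast_ne_zero.mpr hp)).mp ha.2
  exact ⟨i, t • v, by rw [smul_smul]⟩

lemma exists_of_sq_smul_eq_zero (hp : p ≠ 0) {a : A} (ha : (p : ℤ) ^ 2 • a = 0) :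
    ∃ i : ℤ, ∃ b : A, a = i • u + (p : ℤ) • b := by
  obtain ⟨i, j, rfl⟩ := h.exists_eq a
  rw [smul_add, smul_smul, smul_smul, h.eq_zero_iff, pow_succ (p : ℤ) 2] at ha
  obtain ⟨t, rfl⟩ := (mul_dvd_mul_iff_left (pow_ne_zero 2 (Int.natCast_ne_zero.mpr hp))).mp ha.2
  exact ⟨i, t • v, by rw [smul_smul]⟩

lemma sq_smul_eq (a : A) : ∃ j : ℤ, (p : ℤ) ^ 2 • a = j • (p : ℤ) ^ 2 • v := by
  obtain ⟨i, j, rfl⟩ := h.exists_eq a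
  refine ⟨j, ?_⟩
  have : (p : ℤ) ^ 2 • i • u = (i * p) • (p : ℤ) • u := by module
  rw [smul_add, this, h.smul_fst, smul_zero, zero_add, smul_comm]

lemma fst_ne_sq_smul (hp : p.Prime) (b : A) : u ≠ (p : ℤ) ^ 2 • b := by
  intro hu
  obtain ⟨j, hj⟩ := h.sq_smul_eq b
  have h1 := (h.eq_zero_iff 1 (-(j * p ^ 2))).mp (by
    rw [one_smul, hu, hj]; module)
  exact hp.one_lt.ne' (by exact_mod_cast Int.eq_one_of_dvd_one (by positivity) h1.1)

lemma sq_smul_snd_ne_zero (hp : p.Prime) : (p : ℤ) ^ 2 • v ≠ 0 := by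
  intro hv
  have h1 := (h.eq_zero_iff 0 (p ^ 2)).mp (by rw [hv]; simp)
  have h2 : p ^ 3 ∣ p ^ 2 := by exact_mod_cast h1.2
  have := (Nat.pow_dvd_pow_iff_le_right hp.one_lt).mp h2
  omega

end AddGroup

section Brace

variable {A : Type*} [Brace A] {p : ℕ} {u v : A} (h : IsBasisCpCp3 p u v) (hp : p.Prime)
  (hcard : Nat.card A = p ^ 4)
include h hp hcard

lemma bstar_sq_smul (x a : A) : bstar x ((p : ℤ) ^ 2 • a) = 0 := by
  obtain ⟨j, hj⟩ := h.sq_smul_eq a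
  obtain ⟨m, hm⟩ := h.sq_smul_eq (lambdaHom x v)
  have key := AddMonoidHom.sub_mem_of_iterate_prime_pow hp (lambdaHom x) ⊥ (by simp)
    ((p : ℤ) ^ 2 • v) (by
      rw [smul_smul, ← pow_succ']; simp [h.cube_smul]) (by
      simpa using h.sq_smul_snd_ne_zero hp) m (by
      rw [map_zsmul, hm]; simp) 4 (by
      rw [lambdaHom_iterate, ← hcard, pow_card_eq_one', one_bstar, zero_add])
  rw [hj, bstar_zsmul]
  rw [lambdaHom_apply, add_sub_cancel_right, AddSubgroup.mem_bot] at key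
  rw [key, smul_zero]

lemma sq_smul_bstar_eq_zero (x a : A) : (p : ℤ) ^ 2 • bstar x a = 0 := by
  rw [← bstar_zsmul, h.bstar_sq_smul hp hcard]

lemma exists_bstar_fst (x : A) : ∃ b : A, bstar x u = (p : ℤ) ^ 2 • b := by
  have hu : (p : ℤ) • lambdaHom x u = 0 := by rw [← map_zsmul, h.smul_fst, map_zero]
  obtain ⟨m, c, hc⟩ := h.exists_of_smul_eq_zero hp.ne_zero hu
  have key := AddMonoidHom.sub_mem_of_iterate_prime_pow hp (lambdaHom x)
    (zsmulAddGroupHom ((p : ℤ) ^ 2) : A →+ A).range (by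
      rintro _ ⟨b, rfl⟩
      exact ⟨lambdaHom x b, by simp [map_zsmul]⟩) u (by
      rw [h.smul_fst]; exact zero_mem _) (by
      rintro ⟨b, hb⟩
      exact h.fst_ne_sq_smul hp b hb.symm) m (by
      exact ⟨c, by rw [hc]; simp⟩) 4 (by
      rw [lambdaHom_iterate, ← hcard, pow_card_eq_one', one_bstar, zero_add])
  rw [lambdaHom_apply, add_sub_cancel_right] at key
  obtain ⟨b, hb⟩ := key
  exact ⟨b, hb.symm⟩

lemma exists_bstar_of_sq_smul_eq_zero (x : A) {a : A} (ha : (p : ℤ) ^ 2 • a = 0) :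
    ∃ b : A, bstar x a = (p : ℤ) ^ 2 • b := by
  obtain ⟨i, b, rfl⟩ := h.exists_of_sq_smul_eq_zero hp.ne_zero ha
  obtain ⟨c, hc⟩ := h.exists_bstar_fst hp hcard x
  obtain ⟨k, d, hd⟩ := h.exists_of_sq_smul_eq_zero hp.ne_zero
    (h.sq_smul_bstar_eq_zero hp hcard x b)
  refine ⟨i • c + d, ?_⟩
  have : (p : ℤ) • k • u = 0 := by rw [smul_comm, h.smul_fst, smul_zero]
  rw [bstar_add, bstar_zsmul, bstar_zsmul, hc, hd, smul_add, this]
  module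

lemma exists_bstar_bstar (x y a : A) : ∃ b : A, bstar x (bstar y a) = (p : ℤ) ^ 2 • b :=
  h.exists_bstar_of_sq_smul_eq_zero hp hcard x (h.sq_smul_bstar_eq_zero hp hcard y a)

lemma bstar_bstar_bstar (x y z a : A) : bstar x (bstar y (bstar z a)) = 0 := by
  obtain ⟨b, hb⟩ := h.exists_bstar_bstar hp hcard y z a
  rw [hb, h.bstar_sq_smul hp hcard]

lemma smul_bstar_bstar (x y a : A) : (p : ℤ) • bstar x (bstar y a) = 0 := by
  obtain ⟨b, hb⟩ := h.exists_bstar_bstar hp hcard x y a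
  rw [hb, smul_smul, ← pow_succ', h.cube_smul]

lemma mul_sq_smul (x a : A) : x * ((p : ℤ) ^ 2 • a) = x + (p : ℤ) ^ 2 • a := by
  rw [mul_eq_add_add_bstar, h.bstar_sq_smul hp hcard, add_zero]

variable (hp5 : 5 < p)
include hp5

lemma pow_sq (a : A) : a ^ (p ^ 2) = (p : ℤ) ^ 2 • a := by
  have h2 : p ^ 2 ∣ (p ^ 2).choose 2 := by
    have hodd : Odd p := hp.odd_of_ne_two (by omega)
    have : Nat.Coprime (p ^ 2) 2 := Nat.Coprime.pow_left 2 (Nat.coprime_two_right.mpr hodd)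
    refine this.dvd_of_dvd_mul_right ?_
    rw [Nat.choose_two_right, Nat.div_mul_cancel (Nat.even_mul_pred_self _).two_dvd]
    exact Dvd.intro _ rfl
  have h3 : p ∣ (p ^ 2).choose 3 :=
    hp.dvd_choose_pow (by norm_num) (by nlinarith)
  obtain ⟨s, hs⟩ := h2
  obtain ⟨t, ht⟩ := h3
  have e1 := h.sq_smul_bstar_eq_zero hp hcard a a
  have e2 := h.smul_bstar_bstar hp hcard a a a
  rw [pow_of_cube_eq_zero a (h.bstar_bstar_bstar hp hcard _ _ _ _), hs, ht, mul_comm _ s,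
    mul_comm _ t, mul_smul, mul_smul]
  rw [← Nat.cast_pow, natCast_zsmul] at e1 ⊢
  rw [natCast_zsmul] at e2
  rw [e1, e2, smul_zero, smul_zero, add_zero, add_zero]

lemma sq_smul_bstar (a b : A) : bstar ((p : ℤ) ^ 2 • a) b = 0 := by
  have h2 : p ∣ (p ^ 2).choose 2 := hp.dvd_choose_pow (by norm_num) (by nlinarith)
  obtain ⟨t, ht⟩ := h2
  have e1 := h.sq_smul_bstar_eq_zero hp hcard a b
  have e2 := h.smul_bstar_bstar hp hcard a a b
  rw [← Nat.cast_pow, natCast_zsmul] at e1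
  rw [natCast_zsmul] at e2
  rw [← h.pow_sq hp hcard hp5, bstar_pow_of_cube_eq_zero a b (h.bstar_bstar_bstar hp hcard _ _ _ _),
    ht, mul_comm, mul_smul, e1, e2, smul_zero, add_zero]

lemma sq_smul_mul (x a : A) : ((p : ℤ) ^ 2 • a) * x = x + (p : ℤ) ^ 2 • a := by
  rw [mul_eq_add_add_bstar, h.sq_smul_bstar hp hcard hp5, add_zero, add_comm]

lemma exists_mul_eq_mul_add {P Q : A} (hgen : Subgroup.closure ({P, Q} : Set A) = ⊤)
    (hQP : Q⁻¹ * P * Q = P ^ (1 + p ^ 2)) (x y : A) :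
    ∃ b : A, x * y = y * x + (p : ℤ) ^ 2 • b := by
  let N : Subgroup A :=
    { carrier := {z | ∃ b : A, z = (p : ℤ) ^ 2 • b}
      one_mem' := ⟨0, by rw [smul_zero, Brace.one_eq_zero]⟩
      mul_mem' := by
        rintro _ _ ⟨a, rfl⟩ ⟨b, rfl⟩
        exact ⟨a + b, by rw [h.mul_sq_smul hp hcard, smul_add]⟩
      inv_mem' := by
        rintro _ ⟨a, rfl⟩
        refine ⟨-a, inv_eq_of_mul_eq_one_right ?_⟩
        rw [h.mul_sq_smul hp hcard, smul_neg, add_neg_cancel, Brace.one_eq_zero] }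
  have hN : N.Normal := by
    refine ⟨?_⟩
    rintro _ ⟨a, rfl⟩ g
    refine ⟨a, ?_⟩
    rw [h.mul_sq_smul hp hcard, ← h.sq_smul_mul hp hcard hp5, mul_inv_cancel_right]
  have hPQ : (P : A ⧸ N) * Q = Q * P := by
    symm
    rw [← QuotientGroup.mk_mul, ← QuotientGroup.mk_mul, QuotientGroup.eq]
    refine ⟨P, ?_⟩
    have : P * Q = Q * P ^ (1 + p ^ 2) := by rw [← hQP]; group
    rw [this, pow_add, pow_one, h.pow_sq hp hcard hp5]
    group
  have hclosure : Subgroup.closure ({(P : A ⧸ N), (Q : A ⧸ N)} : Set (A ⧸ N)) = ⊤ := by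
    have := MonoidHom.map_closure (QuotientGroup.mk' N) {P, Q}
    rw [hgen, Subgroup.map_top_of_surjective _ (QuotientGroup.mk'_surjective N),
      Set.image_pair] at this
    exact this.symm
  have hcomm : ∀ g k : A ⧸ N, g * k = k * g := by
    have hcent : ∀ g ∈ ({(P : A ⧸ N), (Q : A ⧸ N)} : Set (A ⧸ N)), ∀ k : A ⧸ N,
        g * k = k * g := by
      intro g hg k
      have hle : Subgroup.closure ({(P : A ⧸ N), (Q : A ⧸ N)} : Set (A ⧸ N)) ≤
          Subgroup.centralizer {g} := by
        rw [Subgroup.closure_le]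
        intro z hz
        rw [SetLike.mem_coe, Subgroup.mem_centralizer_singleton_iff]
        rcases hg with rfl | rfl <;> rcases hz with rfl | rfl <;> simp [hPQ]
      rw [hclosure] at hle
      exact (Subgroup.mem_centralizer_singleton_iff.mp (hle (Subgroup.mem_top k))).symm
    intro g k
    have hle : Subgroup.closure ({(P : A ⧸ N), (Q : A ⧸ N)} : Set (A ⧸ N)) ≤
        Subgroup.center (A ⧸ N) := by
      rw [Subgroup.closure_le]
      intro z hz
      exact Subgroup.mem_center_iff.mpr fun k => (hcent z hz k).symm
    rw [hclosure] at hle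
    exact Subgroup.mem_center_iff.mp (hle (Subgroup.mem_top k)) g
  have hxy := hcomm y x
  rw [← QuotientGroup.mk_mul, ← QuotientGroup.mk_mul, QuotientGroup.eq] at hxy
  obtain ⟨b, hb⟩ := hxy
  exact ⟨b, by rw [← h.mul_sq_smul hp hcard, ← hb, mul_inv_cancel_left]⟩

lemma rightNilpotent {P Q : A} (hgen : Subgroup.closure ({P, Q} : Set A) = ⊤)
    (hQP : Q⁻¹ * P * Q = P ^ (1 + p ^ 2)) : RightNilpotent A := by
  have h1 : ∀ z ∈ rightSeries A 1, (p : ℤ) ^ 2 • z = 0 := by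
    suffices rightSeries A 1 ≤ (zsmulAddGroupHom ((p : ℤ) ^ 2) : A →+ A).ker from
      fun z hz => this hz
    refine (AddSubgroup.closure_le _).mpr ?_
    rintro _ ⟨x, -, y, -, rfl⟩
    exact h.sq_smul_bstar_eq_zero hp hcard x y
  have h2 : ∀ z ∈ rightSeries A 2, ∃ b : A, z = (p : ℤ) ^ 2 • b := by
    suffices rightSeries A 2 ≤ (zsmulAddGroupHom ((p : ℤ) ^ 2) : A →+ A).range from
      fun z hz => (this hz).imp fun b hb => hb.symm
    refine (AddSubgroup.closure_le _).mpr ?_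
    rintro _ ⟨x, hx, y, -, rfl⟩
    obtain ⟨b, hb⟩ := h.exists_bstar_of_sq_smul_eq_zero hp hcard y (h1 x hx)
    obtain ⟨c, hc⟩ := h.exists_mul_eq_mul_add hp hcard hp5 hgen hQP x y
    refine ⟨b + c, ?_⟩
    rw [zsmulAddGroupHom_apply, smul_add, ← hb]
    unfold bstar
    rw [hc]
    abel
  refine ⟨3, AddSubgroup.closure_eq_bot_iff.mpr ?_⟩
  rintro _ ⟨x, hx, y, -, rfl⟩
  obtain ⟨b, rfl⟩ := h2 x hx
  exact h.sq_smul_bstar hp hcard hp5 b y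

end Brace

end IsBasisCpCp3

end Brace

/-- braces of cardinality p^4 with additive group C_p × C_{p^3} are right
nilpotent, and x ∗ (p²·a) = 0 for all x, a. -/
theorem brace_CpCp3_right_nilpotent (p : ℕ) (hp : p.Prime) (hp5 : 5 < p)
    (A : Type*) [Brace A] (hcard : Nat.card A = p ^ 4)
    (hadd : Nonempty (A ≃+ ZMod p × ZMod (p ^ 3)))
    (P Q : A) (hgen : Subgroup.closure ({P, Q} : Set A) = ⊤)
    (hP : P ^ (p ^ 3) = 1) (hQ : Q ^ p = 1)
    (hQP : Q⁻¹ * P * Q = P ^ (1 + p ^ 2))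
    (hQadd : p • Q = 0) :
    (∀ x a : A, Brace.bstar x ((p ^ 2) • a) = 0) ∧ Brace.RightNilpotent A := by
  obtain ⟨f⟩ := hadd
  obtain ⟨u, v, h⟩ := Brace.exists_isBasisCpCp3 f
  refine ⟨fun x a => ?_, h.rightNilpotent hp hcard hp5 hgen hQP⟩
  rw [← natCast_zsmul, Nat.cast_pow]
  exact h.bstar_sq_smul hp hcard x a
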